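/- Failure of Green's Theorem 3 in characteristic two: Let k be an algebraically closed field of characteristic 2, r ≥ 3, R = k[x_1,…,x_r], and I = (x_1^2, …, x_r^2). Set m = r − 2. Then: (i) dim_k (R/I)_2 = C(r, 2) = C(m+2, 2); (ii) for a general linear form L, dim_k (R/(I + (L)))_2 = C(r−1, 2) = C(m+1, 2) (the hypotheses of Green's Theorem 3 with d = 2 hold); yet (iii) there is no linear form L_1 ∈ R_1 with I_2 = L_1·R_1, so the conclusion of Green's Theorem 3 fails: I_2 = span_k(x_1^2,…,x_r^2) is not generated by linear forms. -/

import Mathlib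

open MvPolynomial

/-- The degree-`d` graded component of `R/I` (the image of the space of
degree-`d` homogeneous polynomials in the quotient), as a `k`-submodule. -/
noncomputable def gradedPiece (k : Type*) [Field k] (r : ℕ)
    (I : Ideal (MvPolynomial (Fin r) k)) (d : ℕ) :
    Submodule k (MvPolynomial (Fin r) k ⧸ I) :=
  Submodule.map (Ideal.Quotient.mkₐ k I).toLinearMap
    (homogeneousSubmodule (Fin r) k d)

/-- The Hilbert function of `R/I` in degree `d`. -/
noncomputable def hilb (k : Type*) [Field k] (r : ℕ)
    (I : Ideal (MvPolynomial (Fin r) k)) (d : ℕ) : ℕ :=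
  Module.finrank k (gradedPiece k r I d)

/-- `I` is a homogeneous ideal. -/
def IsHomogIdeal {k : Type*} [Field k] {r : ℕ}
    (I : Ideal (MvPolynomial (Fin r) k)) : Prop :=
  ∀ f ∈ I, ∀ n : ℕ, homogeneousComponent n f ∈ I

/-- `I` contains no nonzero linear forms. -/
def NoLinearForms {k : Type*} [Field k] {r : ℕ}
    (I : Ideal (MvPolynomial (Fin r) k)) : Prop :=
  ∀ f ∈ I, f.IsHomogeneous 1 → f = 0

/-- The dimension of the degree-`i` component of the socle of `R/I`. -/
noncomputable def socDim (k : Type*) [Field k] (r : ℕ)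
    (I : Ideal (MvPolynomial (Fin r) k)) (i : ℕ) : ℕ :=
  Module.finrank k (Submodule.map (Ideal.Quotient.mkₐ k I).toLinearMap
    (homogeneousSubmodule (Fin r) k i ⊓
      ⨅ j : Fin r, Submodule.comap (LinearMap.mulLeft k (X j))
        (Submodule.restrictScalars k I)))

/-- `R/I` is a standard graded artinian algebra:
`I` is homogeneous and `R/I` is finite-dimensional over `k`. -/
def StdArtinian (k : Type*) [Field k] (r : ℕ)
    (I : Ideal (MvPolynomial (Fin r) k)) : Prop :=
  IsHomogIdeal I ∧ Module.Finite k (MvPolynomial (Fin r) k ⧸ I)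

/-- `R/I` has socle degree `e`: `e` is the largest degree with nonzero
Hilbert function. -/
def SocleDegree (k : Type*) [Field k] (r : ℕ)
    (I : Ideal (MvPolynomial (Fin r) k)) (e : ℕ) : Prop :=
  hilb k r I e ≠ 0 ∧ ∀ j : ℕ, e < j → hilb k r I j = 0

/-- `R/I` is a standard graded artinian Gorenstein algebra of socle degree `e`:
the socle vanishes below degree `e` and is one-dimensional in degree `e`. -/
def Gorenstein (k : Type*) [Field k] (r e : ℕ)
    (I : Ideal (MvPolynomial (Fin r) k)) : Prop :=
  StdArtinian k r I ∧ SocleDegree k r I e ∧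
    (∀ i : ℕ, i < e → socDim k r I i = 0) ∧ socDim k r I e = 1

/-- `R/I` is a standard graded artinian level algebra of socle degree `e`. -/
def LevelAlg (k : Type*) [Field k] (r e : ℕ)
    (I : Ideal (MvPolynomial (Fin r) k)) : Prop :=
  StdArtinian k r I ∧ SocleDegree k r I e ∧
    (∀ i : ℕ, i < e → socDim k r I i = 0)

/-- The linear form with coefficient vector `c`. -/
noncomputable def linForm {k : Type*} [Field k] {r : ℕ} (c : Fin r → k) :
    MvPolynomial (Fin r) k :=
  ∑ i, C (c i) * X i

/-- A property `P` holds for a general linear form: there is a nonempty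
(basic) Zariski-open subset of the space of linear forms on which `P` holds. -/
def Generically (k : Type*) [Field k] (r : ℕ)
    (P : MvPolynomial (Fin r) k → Prop) : Prop :=
  ∃ Q : MvPolynomial (Fin r) k, Q ≠ 0 ∧
    ∀ c : Fin r → k, eval c Q ≠ 0 → P (linForm c)

/-- `R/I` has the weak Lefschetz property (socle degree `e`): multiplication
by some linear form has maximal rank from each degree `i < e` to degree `i+1`. -/
def WLP (k : Type*) [Field k] (r e : ℕ)
    (I : Ideal (MvPolynomial (Fin r) k)) : Prop :=
  ∃ L : MvPolynomial (Fin r) k, L.IsHomogeneous 1 ∧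
    ∀ i : ℕ, i < e →
      Module.finrank k (Submodule.map
        (LinearMap.mulLeft k (Ideal.Quotient.mk I L)) (gradedPiece k r I i)) =
      min (hilb k r I i) (hilb k r I (i + 1))

/-- The largest `t` with `choose t i ≤ n`: the leading top in the
`i`-binomial expansion of `n`. -/
noncomputable def binTop (n i : ℕ) : ℕ := sSup {t : ℕ | Nat.choose t i ≤ n}

/-- Auxiliary recursion computing `((n)_{(i)})⁻¹₀`, i.e. the sum
`C(n_i - 1, i) + C(n_{i-1} - 1, i-1) + ⋯ + C(n_j - 1, j)` where
`n_{(i)} = C(n_i, i) + ⋯ + C(n_j, j)` is the `i`-binomial expansion of `n`. -/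
noncomputable def greenBoundAux : ℕ → ℕ → ℕ
  | 0, _ => 0
  | (i + 1), n =>
    if n = 0 then 0 else
      Nat.choose (binTop n (i + 1) - 1) (i + 1) +
        greenBoundAux i (n - Nat.choose (binTop n (i + 1)) (i + 1))

/-- `greenBound n i = ((n)_{(i)})⁻¹₀`. -/
noncomputable def greenBound (n i : ℕ) : ℕ := greenBoundAux i n

/-- If a linear map has the same kernel as `R → R/I` on forms of degree `d`, its image on these
forms computes the Hilbert function of `R/I`. -/
lemma hilb_eq_finrank_map {k : Type*} [Field k] {r : ℕ} {I : Ideal (MvPolynomial (Fin r) k)}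
    {d : ℕ} {M : Type*} [AddCommGroup M] [Module k M] (φ : MvPolynomial (Fin r) k →ₗ[k] M)
    (hφ : ∀ f : MvPolynomial (Fin r) k, f.IsHomogeneous d → (f ∈ I ↔ φ f = 0)) :
    hilb k r I d = Module.finrank k (Submodule.map φ (homogeneousSubmodule (Fin r) k d)) := by
  let H := homogeneousSubmodule (Fin r) k d
  let π := (Ideal.Quotient.mkₐ k I).toLinearMap
  have hker : LinearMap.ker (π ∘ₗ H.subtype) = LinearMap.ker (φ ∘ₗ H.subtype) := by
    ext f
    simpa [π, Ideal.Quotient.eq_zero_iff_mem] using hφ f f.2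
  have e := (π ∘ₗ H.subtype).quotKerEquivRange.symm ≪≫ₗ
    Submodule.quotEquivOfEq _ _ hker ≪≫ₗ (φ ∘ₗ H.subtype).quotKerEquivRange
  rw [LinearMap.range_comp, LinearMap.range_comp, Submodule.range_subtype] at e
  exact e.finrank_eq

/-- The ideal `(x_1², …, x_r²)`. -/
noncomputable abbrev squaresIdeal (k : Type*) [Field k] (r : ℕ) :
    Ideal (MvPolynomial (Fin r) k) :=
  Ideal.span (Set.range fun i : Fin r => X i ^ 2)

lemma X_sq_mem_squaresIdeal {k : Type*} [Field k] {r : ℕ} (i : Fin r) :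
    (X i ^ 2 : MvPolynomial (Fin r) k) ∈ squaresIdeal k r :=
  Ideal.subset_span ⟨i, rfl⟩

lemma mem_squaresIdeal_iff {k : Type*} [Field k] {r : ℕ} {f : MvPolynomial (Fin r) k} :
    f ∈ squaresIdeal k r ↔ ∀ m ∈ f.support, ∃ i, 2 ≤ m i := by
  have h := @mem_ideal_span_monomial_image (Fin r) k _ f (Set.range fun i => Finsupp.single i 2)
  rw [← Set.range_comp] at h
  have h2 : ((fun s => monomial s (1 : k)) ∘ fun i : Fin r => Finsupp.single i 2) =
      fun i => X i ^ 2 := by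
    ext1 i
    simp [X_pow_eq_monomial]
  rw [h2] at h
  simpa using h

/-- The exponent vector of the squarefree monomial `∏ i ∈ s, x_i`. -/
noncomputable def squarefreeExponent {r : ℕ} (s : Finset (Fin r)) : Fin r →₀ ℕ :=
  Finsupp.indicator s fun _ _ => 1

lemma squarefreeExponent_apply {r : ℕ} (s : Finset (Fin r)) (i : Fin r) :
    squarefreeExponent s i = if i ∈ s then 1 else 0 := by
  simp [squarefreeExponent, Finsupp.indicator_apply]

lemma degree_squarefreeExponent {r : ℕ} (s : Finset (Fin r)) :
    (squarefreeExponent s).degree = s.card := by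
  simp [Finsupp.degree_eq_sum, squarefreeExponent_apply]

lemma squarefreeExponent_injective {r : ℕ} :
    Function.Injective (squarefreeExponent (r := r)) := by
  intro s t h
  ext i
  have := DFunLike.congr_fun h i
  simp only [squarefreeExponent_apply] at this
  split_ifs at this <;> simp_all

lemma squarefreeExponent_support {r : ℕ} {m : Fin r →₀ ℕ} (hm : ∀ i, m i < 2) :
    squarefreeExponent m.support = m := by
  ext i
  have := hm i
  simp only [squarefreeExponent_apply, Finsupp.mem_support_iff]
  split_ifs <;> omega

lemma hilb_squaresIdeal (k : Type*) [Field k] (r d : ℕ) :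
    hilb k r (squaresIdeal k r) d = r.choose d := by
  let φ : MvPolynomial (Fin r) k →ₗ[k] ({s : Finset (Fin r) // s.card = d} → k) :=
    LinearMap.pi fun s => lcoeff k (squarefreeExponent s.1)
  have hφ (f : MvPolynomial (Fin r) k) (s) : φ f s = coeff (squarefreeExponent s.1) f := rfl
  rw [hilb_eq_finrank_map φ]
  · have hsurj : Submodule.map φ (homogeneousSubmodule (Fin r) k d) = ⊤ := by
      refine eq_top_iff.2 fun v _ => ⟨∑ s, monomial (squarefreeExponent s.1) (v s), ?_, ?_⟩
      · exact Submodule.sum_mem _ fun s _ =>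
          isHomogeneous_monomial _ ((degree_squarefreeExponent s.1).trans s.2)
      · ext s
        simp [hφ, coeff_sum, coeff_monomial, squarefreeExponent_injective.eq_iff,
          Subtype.coe_inj]
    rw [hsurj, finrank_top, Module.finrank_fintype_fun_eq_card, Fintype.card_finset_len,
      Fintype.card_fin]
  · intro f hf
    rw [mem_squaresIdeal_iff]
    constructor
    · intro h
      ext s
      by_contra hs
      obtain ⟨i, hi⟩ := h _ (mem_support_iff.2 hs)
      rw [squarefreeExponent_apply] at hi
      split_ifs at hi <;> omega
    · intro h m hm
      by_contra! hlt
      have hsq := squarefreeExponent_support hlt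
      have hcard : m.support.card = d := by
        rw [← degree_squarefreeExponent, hsq, hf.degree_eq_sum_deg_support hm]
        rfl
      have := congr_fun h ⟨m.support, hcard⟩
      rw [hφ, hsq] at this
      exact mem_support_iff.1 hm this

lemma isHomogeneous_linForm {k : Type*} [Field k] {r : ℕ} (c : Fin r → k) :
    (linForm c).IsHomogeneous 1 :=
  IsHomogeneous.sum _ _ _ fun i _ => isHomogeneous_C_mul_X (c i) i

lemma linForm_sq_mem_squaresIdeal {k : Type*} [Field k] [CharP k 2] {r : ℕ} (c : Fin r → k) :
    linForm c ^ 2 ∈ squaresIdeal k r := by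
  rw [linForm, sum_pow_char 2]
  refine Ideal.sum_mem _ fun i _ => ?_
  rw [mul_pow]
  exact Ideal.mul_mem_left _ _ (X_sq_mem_squaresIdeal i)

/-- In characteristic two, eliminating `x_0` by means of a linear form in which it occurs
reduces the squares ideal in `n + 1` variables to the squares ideal in `n` variables. -/
lemma hilb_squaresIdeal_sup_linForm {k : Type*} [Field k] [CharP k 2] {n : ℕ}
    {c : Fin (n + 1) → k} (hc : c 0 ≠ 0) (d : ℕ) :
    hilb k (n + 1) (squaresIdeal k (n + 1) ⊔ Ideal.span {linForm c}) d =
      hilb k n (squaresIdeal k n) d := by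
  set J := squaresIdeal k (n + 1) ⊔ Ideal.span {linForm c}
  let b : Fin n → k := fun i => -((c 0)⁻¹ * c i.succ)
  let σ : MvPolynomial (Fin (n + 1)) k →ₐ[k] MvPolynomial (Fin n) k :=
    aeval (Fin.cons (linForm b) X)
  let τ : MvPolynomial (Fin n) k →ₐ[k] MvPolynomial (Fin (n + 1)) k := rename Fin.succ
  have hσ0 : σ (X 0) = linForm b := by simp [σ]
  have hσs (i : Fin n) : σ (X i.succ) = X i := by simp [σ]
  have hστ (g : MvPolynomial (Fin n) k) : σ (τ g) = g := by
    have : σ.comp τ = AlgHom.id k _ := by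
      ext1 i
      simp [τ, hσs]
    exact DFunLike.congr_fun this g
  have hσhom {f} (hf : f.IsHomogeneous d) : (σ f).IsHomogeneous d := by
    rw [← one_mul d]
    refine hf.aeval _ fun i => ?_
    refine Fin.cases ?_ (fun j => ?_) i
    · simpa using isHomogeneous_linForm b
    · simpa using isHomogeneous_X k j
  have hσL : σ (linForm c) = 0 := by
    have hC (a : k) : σ (C a) = C a := σ.commutes a
    simp only [linForm, map_sum, map_mul, map_add, Fin.sum_univ_succ, hσ0, hσs, hC, Finset.mul_sum]
    rw [← Finset.sum_add_distrib]
    refine Finset.sum_eq_zero fun i _ => ?_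
    rw [← mul_assoc, ← C_mul, ← add_mul, ← C_add]
    simp [b, hc]
  have hσJ : J ≤ (squaresIdeal k n).comap σ := by
    refine sup_le (Ideal.span_le.2 ?_) (Ideal.span_le.2 ?_)
    · rintro _ ⟨i, rfl⟩
      refine Fin.cases ?_ (fun j => ?_) i
      · simpa [hσ0] using linForm_sq_mem_squaresIdeal b
      · simpa [hσs] using X_sq_mem_squaresIdeal j
    · simp [hσL]
  have hτJ : squaresIdeal k n ≤ J.comap τ := by
    refine Ideal.span_le.2 ?_
    rintro _ ⟨i, rfl⟩
    simpa [τ] using Ideal.mem_sup_left (X_sq_mem_squaresIdeal i.succ)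
  have hX0 : τ (linForm b) - X 0 ∈ J := by
    have : τ (linForm b) - X 0 = -C (c 0)⁻¹ * linForm c := by
      have h0 : C (c 0)⁻¹ * C (c 0) = (1 : MvPolynomial (Fin (n + 1)) k) := by
        rw [← C_mul, inv_mul_cancel₀ hc, C_1]
      simp only [linForm, τ, b, map_sum, map_mul, map_neg, rename_C, rename_X,
        Fin.sum_univ_succ, mul_add, Finset.mul_sum, neg_mul, ← mul_assoc, h0, one_mul,
        Finset.sum_neg_distrib]
      ring
    rw [this]
    exact Ideal.mul_mem_left _ _ (Ideal.mem_sup_right (Ideal.mem_span_singleton_self _))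
  have hτσ (f : MvPolynomial (Fin (n + 1)) k) : τ (σ f) - f ∈ J := by
    have : ((Ideal.Quotient.mkₐ k J).comp τ).comp σ = Ideal.Quotient.mkₐ k J := by
      ext1 i
      refine Fin.cases ?_ (fun j => ?_) i
      · simpa [hσ0] using (Ideal.Quotient.eq).2 hX0
      · simp [hσs, τ]
    exact (Ideal.Quotient.eq).1 (DFunLike.congr_fun this f)
  have hmem (f : MvPolynomial (Fin (n + 1)) k) : f ∈ J ↔ σ f ∈ squaresIdeal k n :=
    ⟨fun h => hσJ h, fun h => by simpa using J.sub_mem (hτJ h) (hτσ f)⟩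
  have himage : Submodule.map σ.toLinearMap (homogeneousSubmodule (Fin (n + 1)) k d) =
      homogeneousSubmodule (Fin n) k d := by
    refine le_antisymm ?_ fun g hg => ⟨τ g, IsHomogeneous.rename_isHomogeneous hg, hστ g⟩
    rintro _ ⟨f, hf, rfl⟩
    exact hσhom hf
  rw [hilb_eq_finrank_map ((Ideal.Quotient.mkₐ k (squaresIdeal k n)).toLinearMap ∘ₗ
    σ.toLinearMap), Submodule.map_comp, himage]
  · rfl
  · intro f _
    simpa [Ideal.Quotient.eq_zero_iff_mem] using hmem f

/-- No linear form divides the squares of two distinct variables. -/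
lemma not_dvd_X_sq_of_isHomogeneous_one {k : Type*} [Field k] {r : ℕ} {i j : Fin r}
    (hij : i ≠ j) {L : MvPolynomial (Fin r) k} (hL : L.IsHomogeneous 1)
    (hi : L ∣ X i ^ 2) : ¬ L ∣ X j ^ 2 := by
  intro hj
  have hrel : IsRelPrime (X i : MvPolynomial (Fin r) k) (X j) :=
    X_prime.irreducible.isRelPrime_iff_not_dvd.2 fun h => hij (X_dvd_X.1 h)
  have hu : IsUnit (constantCoeff L) := (hrel.pow hi hj).map constantCoeff
  refine hu.ne_zero ?_
  rw [constantCoeff_eq]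
  exact hL.coeff_eq_zero (by simp)

/-- Remark 2.4: failure of Green's Theorem 3 in characteristic two. For
`I = (x_1², …, x_r²)` in `R = k[x_1, …, x_r]` over an algebraically closed
field of characteristic `2`, and `m = r - 2`: (i) `dim_k (R/I)_2 = C(r,2) =
C(m+2,2)`; (ii) for a general linear form `L`,
`dim_k (R/(I+(L)))_2 = C(r-1,2) = C(m+1,2)`; yet (iii) there is no linear form
`L₁` with `I_2 = L₁ · R_1`, so the conclusion of Green's Theorem 3 fails. -/
theorem green_theorem_3_fails_char_two
    (k : Type*) [Field k] [IsAlgClosed k] [CharP k 2]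
    (r : ℕ) (hr : 3 ≤ r)
    (I : Ideal (MvPolynomial (Fin r) k))
    (hI : I = Ideal.span (Set.range fun i : Fin r => X i ^ 2)) :
    hilb k r I 2 = Nat.choose r 2 ∧
    Nat.choose r 2 = Nat.choose (r - 2 + 2) 2 ∧
    Generically k r (fun L =>
      hilb k r (I ⊔ Ideal.span {L}) 2 = Nat.choose (r - 1) 2) ∧
    Nat.choose (r - 1) 2 = Nat.choose (r - 2 + 1) 2 ∧
    ¬ ∃ L1 : MvPolynomial (Fin r) k, L1.IsHomogeneous 1 ∧
      Submodule.restrictScalars k I ⊓ homogeneousSubmodule (Fin r) k 2 =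
        Submodule.map (LinearMap.mulLeft k L1)
          (homogeneousSubmodule (Fin r) k 1) := by
  subst hI
  refine ⟨hilb_squaresIdeal k r 2, by rw [Nat.sub_add_cancel (by omega)], ?_,
    by rw [show r - 2 + 1 = r - 1 by omega], ?_⟩
  · obtain ⟨n, rfl⟩ : ∃ n, r = n + 1 := ⟨r - 1, by omega⟩
    refine ⟨X 0, X_ne_zero 0, fun c hc => ?_⟩
    rw [eval_X] at hc
    exact (hilb_squaresIdeal_sup_linForm hc 2).trans (hilb_squaresIdeal k n 2)
  · rintro ⟨L, hL, hEq⟩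
    have hdvd (i : Fin r) : L ∣ X i ^ 2 := by
      have hmem : (X i ^ 2 : MvPolynomial (Fin r) k) ∈
          Submodule.restrictScalars k (squaresIdeal k r) ⊓ homogeneousSubmodule (Fin r) k 2 :=
        ⟨X_sq_mem_squaresIdeal i, isHomogeneous_X_pow i 2⟩
      rw [hEq] at hmem
      obtain ⟨g, -, hg⟩ := hmem
      exact ⟨g, hg.symm⟩
    have h01 : (⟨0, by omega⟩ : Fin r) ≠ ⟨1, by omega⟩ := by simp
    exact not_dvd_X_sq_of_isHomogeneous_one h01 hL (hdvd _) (hdvd _)
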